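/- For all θ₁,θ₂ ∈ (0,π) and ψ ∈ ℝ, the complex special Killing 2-form Ψ := 3 sin θ₁ sin θ₂ e^{iψ} (T₂∧T₃ − (1/2)T₁∧T₃ + (1/2)T₁∧T₂) decomposes as Ψ = (3/2)(Ψ_R + iΨ_I) in Λ(ℂ⁵), where the two real 2-forms (elements with real coefficients) are Ψ_R = cos ψ dθ₁∧dθ₂ + sin θ₂ sin ψ dθ₁∧dφ₂ − sin θ₁ sin ψ dθ₂∧dφ₁ − sin θ₁ sin θ₂ cos ψ dφ₁∧dφ₂ and Ψ_I = sin ψ dθ₁∧dθ₂ − sin θ₂ cos ψ dθ₁∧dφ₂ + sin θ₁ cos ψ dθ₂∧dφ₁ − sin θ₁ sin θ₂ sin ψ dφ₁∧dφ₂. (Ψ_R and Ψ_I are, up to a multiplicative constant, the two real special Killing 2-forms on T^{1,1} coming from the holomorphic volume form of the conifold and its conjugate.) -/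

import Mathlib

open ExteriorAlgebra

/-- The basis 1-forms `(dθ₁, dθ₂, dφ₁, dφ₂, dψ)` of `Λ(ℂ⁵)`. -/
noncomputable def dform (i : Fin 5) : ExteriorAlgebra ℂ (Fin 5 → ℂ) :=
  ExteriorAlgebra.ι ℂ (Pi.single i 1)

noncomputable def dθ₁ : ExteriorAlgebra ℂ (Fin 5 → ℂ) := dform 0
noncomputable def dθ₂ : ExteriorAlgebra ℂ (Fin 5 → ℂ) := dform 1
noncomputable def dφ₁ : ExteriorAlgebra ℂ (Fin 5 → ℂ) := dform 2
noncomputable def dφ₂ : ExteriorAlgebra ℂ (Fin 5 → ℂ) := dform 3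
noncomputable def dψ : ExteriorAlgebra ℂ (Fin 5 → ℂ) := dform 4

/-- `T₁`, the non-radial part of `dz¹` on the conifold. -/
noncomputable def T₁ (θ₁ θ₂ : ℝ) : ExteriorAlgebra ℂ (Fin 5 → ℂ) :=
  (Real.cot θ₁ : ℂ) • dθ₁ + (Real.cot θ₂ : ℂ) • dθ₂ + Complex.I • dψ

/-- `T₂`, the non-radial part of `dz²` on the conifold. -/
noncomputable def T₂ (θ₁ θ₂ : ℝ) : ExteriorAlgebra ℂ (Fin 5 → ℂ) :=
  ((Real.cot (θ₁/2) : ℂ)/2) • dθ₁ - ((Real.tan (θ₂/2) : ℂ)/2) • dθ₂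
    + (Complex.I/2) • (dψ - dφ₁ + dφ₂)

/-- `T₃`, the non-radial part of `dz³` on the conifold. -/
noncomputable def T₃ (θ₁ θ₂ : ℝ) : ExteriorAlgebra ℂ (Fin 5 → ℂ) :=
  ((Real.cot (θ₁/2) : ℂ)/2) • dθ₁ + ((Real.cot (θ₂/2) : ℂ)/2) • dθ₂
    + (Complex.I/2) • (dψ - dφ₁ - dφ₂)

/-- The real part `Ψ_R = ℜΨ` of the special Killing 2-form on `T^{1,1}`
(a 2-form with real coefficients). -/
noncomputable def ΨR (θ₁ θ₂ ψ : ℝ) : ExteriorAlgebra ℂ (Fin 5 → ℂ) :=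
  ((Real.cos ψ : ℝ) : ℂ) • (dθ₁ * dθ₂)
    + ((Real.sin θ₂ * Real.sin ψ : ℝ) : ℂ) • (dθ₁ * dφ₂)
    - ((Real.sin θ₁ * Real.sin ψ : ℝ) : ℂ) • (dθ₂ * dφ₁)
    - ((Real.sin θ₁ * Real.sin θ₂ * Real.cos ψ : ℝ) : ℂ) • (dφ₁ * dφ₂)

/-- The imaginary part `Ψ_I = ℑΨ` of the special Killing 2-form on `T^{1,1}`
(a 2-form with real coefficients). -/
noncomputable def ΨI (θ₁ θ₂ ψ : ℝ) : ExteriorAlgebra ℂ (Fin 5 → ℂ) :=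
  ((Real.sin ψ : ℝ) : ℂ) • (dθ₁ * dθ₂)
    - ((Real.sin θ₂ * Real.cos ψ : ℝ) : ℂ) • (dθ₁ * dφ₂)
    + ((Real.sin θ₁ * Real.cos ψ : ℝ) : ℂ) • (dθ₂ * dφ₁)
    - ((Real.sin θ₁ * Real.sin θ₂ * Real.sin ψ : ℝ) : ℂ) • (dφ₁ * dφ₂)

theorem dform_sq (i : Fin 5) : dform i * dform i = 0 := by
  simp [dform, ExteriorAlgebra.ι_sq_zero]

theorem dform_anti (i j : Fin 5) : dform j * dform i = - (dform i * dform j) := by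
  have h := ExteriorAlgebra.ι_add_mul_swap (R := ℂ) (M := Fin 5 → ℂ) (Pi.single j 1) (Pi.single i 1)
  exact eq_neg_of_add_eq_zero_left h

theorem T₂_sq (x y : ℝ) : T₂ x y * T₂ x y = 0 := by
  have : T₂ x y = ExteriorAlgebra.ι ℂ (((Real.cot (x/2) : ℂ)/2) • Pi.single 0 1
      - ((Real.tan (y/2) : ℂ)/2) • Pi.single 1 1
      + (Complex.I/2) • (Pi.single 4 1 - Pi.single 2 1 + Pi.single 3 1)) := by
    simp only [map_add, map_sub, map_smul]
    rfl
  rw [this, ExteriorAlgebra.ι_sq_zero]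

theorem half_facts (x : ℝ) (h : x ∈ Set.Ioo 0 Real.pi) :
    Real.cot (x/2) - Real.cot x = 1 / Real.sin x ∧
    Real.tan (x/2) + Real.cot x = 1 / Real.sin x ∧ Real.sin x ≠ 0 := by
  have hs : Real.sin (x/2) ≠ 0 :=
    (Real.sin_pos_of_pos_of_lt_pi (by linarith [h.1]) (by linarith [h.1, h.2])).ne'
  have hc : Real.cos (x/2) ≠ 0 :=
    (Real.cos_pos_of_mem_Ioo ⟨by linarith [h.1, h.2], by linarith [h.2]⟩).ne'
  have e1 : Real.sin x = 2 * Real.sin (x/2) * Real.cos (x/2) := by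
    rw [← Real.sin_two_mul]; congr 1; ring
  have e2 : Real.cos x = 2 * Real.cos (x/2) ^ 2 - 1 := by
    rw [← Real.cos_two_mul]; congr 1; ring
  have e3 := Real.sin_sq_add_cos_sq (x/2)
  refine ⟨?_, ?_, (Real.sin_pos_of_pos_of_lt_pi h.1 h.2).ne'⟩
  · rw [Real.cot_eq_cos_div_sin, Real.cot_eq_cos_div_sin, e1, e2]
    field_simp
    ring
  · rw [Real.tan_eq_sin_div_cos, Real.cot_eq_cos_div_sin, e1, e2]
    field_simp
    linear_combination 2 * e3

/-- the complex special Killing 2-form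
`Ψ = 3 sin θ₁ sin θ₂ e^{iψ}(T₂∧T₃ − ½T₁∧T₃ + ½T₁∧T₂)` decomposes into real and imaginary
parts as `Ψ = (3/2)(Ψ_R + iΨ_I)`. -/
theorem special_killing_form_real_imaginary_parts (θ₁ θ₂ ψ : ℝ)
    (h₁ : θ₁ ∈ Set.Ioo 0 Real.pi) (h₂ : θ₂ ∈ Set.Ioo 0 Real.pi) :
    (((3 * Real.sin θ₁ * Real.sin θ₂ : ℝ) : ℂ) * Complex.exp (Complex.I * ψ)) •
        (T₂ θ₁ θ₂ * T₃ θ₁ θ₂ - ((1:ℂ)/2) • (T₁ θ₁ θ₂ * T₃ θ₁ θ₂)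
          + ((1:ℂ)/2) • (T₁ θ₁ θ₂ * T₂ θ₁ θ₂)) =
      ((3:ℂ)/2) • (ΨR θ₁ θ₂ ψ + Complex.I • ΨI θ₁ θ₂ ψ) := by
  obtain ⟨a1, b1, n1⟩ := half_facts θ₁ h₁
  obtain ⟨a2, b2, n2⟩ := half_facts θ₂ h₂
  have a1c : (Real.cot (θ₁/2) : ℂ) = Real.cot θ₁ + 1 / (Real.sin θ₁ : ℂ) := by
    rw [sub_eq_iff_eq_add'] at a1; rw [a1]; push_cast; rfl
  have a2c : (Real.cot (θ₂/2) : ℂ) = Real.cot θ₂ + 1 / (Real.sin θ₂ : ℂ) := by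
    rw [sub_eq_iff_eq_add'] at a2; rw [a2]; push_cast; rfl
  have b2c : (Real.tan (θ₂/2) : ℂ) = 1 / (Real.sin θ₂ : ℂ) - Real.cot θ₂ := by
    rw [← eq_sub_iff_add_eq] at b2; rw [b2]; push_cast; rfl
  have n1c : (Real.sin θ₁ : ℂ) ≠ 0 := by exact_mod_cast n1
  have n2c : (Real.sin θ₂ : ℂ) ≠ 0 := by exact_mod_cast n2
  have hexp : Complex.exp (Complex.I * ψ) = (Real.cos ψ : ℂ) + (Real.sin ψ : ℂ) * Complex.I := by
    rw [mul_comm, Complex.exp_mul_I, Complex.ofReal_cos, Complex.ofReal_sin]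
  have hW : T₂ θ₁ θ₂ * T₃ θ₁ θ₂ - ((1:ℂ)/2) • (T₁ θ₁ θ₂ * T₃ θ₁ θ₂)
          + ((1:ℂ)/2) • (T₁ θ₁ θ₂ * T₂ θ₁ θ₂)
      = (T₂ θ₁ θ₂ - ((1:ℂ)/2) • T₁ θ₁ θ₂) * (T₃ θ₁ θ₂ - T₂ θ₁ θ₂) := by
    rw [sub_mul, mul_sub, mul_sub, T₂_sq, smul_mul_assoc, smul_mul_assoc]
    abel
  have hA : T₂ θ₁ θ₂ - ((1:ℂ)/2) • T₁ θ₁ θ₂ = ((1:ℂ)/2) • ((1 / (Real.sin θ₁ : ℂ)) • dθ₁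
      - (1 / (Real.sin θ₂ : ℂ)) • dθ₂ - Complex.I • dφ₁ + Complex.I • dφ₂) := by
    rw [T₂, T₁, a1c, b2c]
    module
  have hB : T₃ θ₁ θ₂ - T₂ θ₁ θ₂ = (1 / (Real.sin θ₂ : ℂ)) • dθ₂ - Complex.I • dφ₂ := by
    rw [T₂, T₃, a2c, b2c]
    module
  have q1 : dθ₂ * dθ₂ = 0 := dform_sq 1
  have q2 : dφ₂ * dφ₂ = 0 := dform_sq 3
  have q3 : dφ₁ * dθ₂ = -(dθ₂ * dφ₁) := dform_anti 1 2
  have q4 : dφ₂ * dθ₂ = -(dθ₂ * dφ₂) := dform_anti 1 3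
  rw [hW, hA, hB, hexp, ΨR, ΨI]
  simp only [sub_mul, add_mul, mul_sub, smul_mul_assoc, mul_smul_comm, q1, q2, q3, q4]
  have hI := Complex.I_mul_I
  simp only [Complex.ofReal_mul, Complex.ofReal_ofNat]
  generalize (Real.sin θ₁ : ℂ) = s at *
  generalize (Real.sin θ₂ : ℂ) = t at *
  generalize (Real.sin ψ : ℂ) = u at *
  generalize (Real.cos ψ : ℂ) = v at *
  match_scalars <;> field_simp <;> grind
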